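/- For every n ∈ ℕ let (F_{n,k})_{k∈ℕ} be a filtration on a probability space (Ω, F, P) and let (D_{n,k})_{k≥1} be real random variables; let (s_n)_{n∈ℕ} be a sequence of natural numbers and s ∈ [0, ∞). Set V_{n,k} = Σ_{j=1}^{k} E[D_{n,j}² | F_{n,j−1}] and M_n = Σ_{k=1}^{s_n} D_{n,k}. Assume: (a) for all n and k ≥ 1, D_{n,k} is F_{n,k}-measurable, E[D_{n,k}²] < ∞ and P-a.s. E[D_{n,k} | F_{n,k−1}] = 0; (b) there exist a filtration (G_j)_{j∈ℕ} on (Ω, F) and a sequence of natural numbers (r_n)_{n∈ℕ} such that F_{n,0} = G_{r_n} for every n; (c) for every ε ∈ (0,1), P-a.s. lim_{n→∞} Σ_{k=1}^{s_n} E[D_{n,k}² · 1{|D_{n,k}| > ε} | F_{n,k−1}] = 0; (d') for every ε ∈ (0,1), P-a.s. lim_{n→∞} E[ 1{|V_{n,s_n} − s| > ε} | F_{n,0}] = 0. Then for every λ ∈ ℝ, P-a.s. lim_{n→∞} E[exp(iλ M_n) | F_{n,0}] = exp(−s λ² / 2). -/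

import Mathlib

open MeasureTheory Filter Topology

lemma aux_exp_I (x : ℝ) :
    ‖Complex.exp ((x : ℂ) * Complex.I) - 1 - (x : ℂ) * Complex.I + (x : ℂ) ^ 2 / 2‖ ≤ 4 * |x| ^ 3 ∧
    ‖Complex.exp ((x : ℂ) * Complex.I) - 1 - (x : ℂ) * Complex.I + (x : ℂ) ^ 2 / 2‖ ≤ 4 * x ^ 2 := by
  have h0 : 0 ≤ |x| := abs_nonneg x
  have hsq : x ^ 2 = |x| ^ 2 := (sq_abs x).symm
  rcases le_total |x| 1 with h | h
  · have hb := Complex.exp_bound (x := (x : ℂ) * Complex.I) (by simpa using h) (n := 3) (by norm_num)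
    have e : Complex.exp ((x : ℂ) * Complex.I) - 1 - (x : ℂ) * Complex.I + (x : ℂ) ^ 2 / 2
        = Complex.exp ((x : ℂ) * Complex.I) -
          ∑ m ∈ Finset.range 3, ((x : ℂ) * Complex.I) ^ m / (m.factorial : ℂ) := by
      simp [Finset.sum_range_succ, mul_pow, Nat.factorial]
      ring
    have hn : ‖(x : ℂ) * Complex.I‖ = |x| := by simp
    rw [← e, hn] at hb
    have h3 : |x| ^ 3 ≤ |x| ^ 2 := pow_le_pow_of_le_one h0 h (by norm_num)
    have h30 : 0 ≤ |x| ^ 3 := by positivity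
    norm_num [Nat.factorial] at hb
    constructor
    · linarith
    · rw [hsq]; linarith
  · have hb : ‖Complex.exp ((x : ℂ) * Complex.I) - 1 - (x : ℂ) * Complex.I + (x : ℂ) ^ 2 / 2‖
        ≤ 1 + 1 + |x| + |x| ^ 2 / 2 := by
      refine (norm_add_le _ _).trans ?_
      refine (add_le_add_left (norm_sub_le _ _) _).trans ?_
      refine (add_le_add_left (add_le_add_left (norm_sub_le _ _) _) _).trans ?_
      simp [Complex.norm_exp_ofReal_mul_I]
    have h3 : |x| ^ 2 ≤ |x| ^ 3 := pow_le_pow_right₀ h (by norm_num)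
    constructor
    · nlinarith
    · rw [hsq]; nlinarith

lemma aux_exp_neg (y : ℝ) (hy : 0 ≤ y) : |Real.exp (-y) - 1 + y| ≤ y ^ 2 := by
  rcases le_total y 1 with h | h
  · have := Real.abs_exp_sub_one_sub_id_le (x := -y) (by rw [abs_neg, abs_of_nonneg hy]; exact h)
    simpa using this
  · have h1 := Real.add_one_le_exp (-y)
    have h2 : Real.exp (-y) ≤ 1 := Real.exp_le_one_iff.2 (by linarith)
    rw [abs_le]; constructor <;> nlinarith

lemma aux_exp_abs (x : ℝ) : |1 - Real.exp x| ≤ |x| * Real.exp |x| := by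
  have h1 := Real.add_one_le_exp x
  have h2 := Real.add_one_le_exp (-x)
  have h3 : Real.exp x ≤ Real.exp |x| := Real.exp_le_exp.2 (le_abs_self x)
  have h4 : 1 ≤ Real.exp |x| := Real.one_le_exp (abs_nonneg x)
  have h5 : Real.exp (-x) * Real.exp x = 1 := by rw [← Real.exp_add]; simp
  have h6 := Real.exp_pos x
  rcases le_total 0 x with h | h
  · rw [abs_of_nonneg h] at *
    rw [abs_of_nonpos (by linarith)]
    nlinarith
  · rw [abs_of_nonpos h] at *
    rw [abs_of_nonneg (by linarith [Real.exp_le_one_iff.2 h])]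
    nlinarith

/-- conditional expectations of bounded a.s. null sequences along a filtration. -/
lemma aux_max {Ω : Type*} {m0 : MeasurableSpace Ω} {μ : Measure Ω} [IsProbabilityMeasure μ]
    (𝒢 : Filtration ℕ m0) (r : ℕ → ℕ) (X : ℕ → Ω → ℝ) (K : ℝ)
    (hm : ∀ n, Measurable (X n)) (h0 : ∀ n ω, 0 ≤ X n ω) (hK : ∀ n ω, X n ω ≤ K)
    (hX : ∀ᵐ ω ∂μ, Tendsto (fun n => X n ω) atTop (𝓝 0)) :
    ∀ᵐ ω ∂μ, Tendsto (fun n => (μ[X n | 𝒢 (r n)]) ω) atTop (𝓝 0) := by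
  set Z : ℕ → Ω → ℝ := fun N ω => ⨆ n, X (N + n) ω with hZ
  have hbdd : ∀ N ω, BddAbove (Set.range fun n => X (N + n) ω) := fun N ω =>
    ⟨K, by rintro _ ⟨n, rfl⟩; exact hK _ _⟩
  have hXZ : ∀ N n ω, N ≤ n → X n ω ≤ Z N ω := by
    intro N n ω h
    obtain ⟨k, rfl⟩ := Nat.exists_eq_add_of_le h
    exact le_ciSup (hbdd N ω) k
  have hZ0 : ∀ N ω, 0 ≤ Z N ω := fun N ω => (h0 N ω).trans (hXZ N N ω le_rfl)
  have hZK : ∀ N ω, Z N ω ≤ K := fun N ω => ciSup_le fun n => hK _ _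
  have hZm : ∀ N, Measurable (Z N) := fun N => Measurable.iSup fun n => hm _
  have hint : ∀ f : Ω → ℝ, Measurable f → (∀ ω, 0 ≤ f ω) → (∀ ω, f ω ≤ K) → Integrable f μ := by
    intro f hf h1 h2
    refine Integrable.of_bound hf.aestronglyMeasurable K (ae_of_all _ fun ω => ?_)
    rw [Real.norm_of_nonneg (h1 ω)]; exact h2 ω
  have hZi : ∀ N, Integrable (Z N) μ := fun N => hint _ (hZm N) (hZ0 N) (hZK N)
  have hXi : ∀ N, Integrable (X N) μ := fun N => hint _ (hm N) (h0 N) (hK N)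
  have hZlim : ∀ᵐ ω ∂μ, Tendsto (fun N => Z N ω) atTop (𝓝 0) := by
    filter_upwards [hX] with ω hω
    rw [Metric.tendsto_atTop] at hω ⊢
    intro ε hε
    obtain ⟨N, hN⟩ := hω (ε / 2) (by linarith)
    refine ⟨N, fun n hn => ?_⟩
    rw [Real.dist_0_eq_abs, abs_of_nonneg (hZ0 n ω)]
    have : Z n ω ≤ ε / 2 := ciSup_le fun k => by
      have := hN (n + k) (by omega)
      rw [Real.dist_0_eq_abs, abs_of_nonneg (h0 _ _)] at this
      exact this.le
    linarith
  have hZint : Tendsto (fun N => ∫ ω, Z N ω ∂μ) atTop (𝓝 0) := by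
    have := tendsto_integral_of_dominated_convergence (μ := μ) (F := Z) (f := fun _ => (0 : ℝ))
      (fun _ => K) (fun N => (hZm N).aestronglyMeasurable) (integrable_const K)
      (fun N => ae_of_all _ fun ω => by rw [Real.norm_of_nonneg (hZ0 N ω)]; exact hZK N ω) hZlim
    simpa using this
  -- maximal inequality
  have hmax : ∀ (N : ℕ) (δ : NNReal), 0 < δ →
      δ * μ {ω | ∃ j, (δ : ℝ) ≤ max 0 ((μ[Z N | 𝒢 j]) ω)} ≤ ENNReal.ofReal (∫ ω, Z N ω ∂μ) := by
    intro N δ hδ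
    set f : ℕ → Ω → ℝ := fun j ω => max 0 ((μ[Z N | 𝒢 j]) ω) with hf
    have hsub : Submartingale f 𝒢 μ := by
      have h1 := (martingale_condExp (Z N) 𝒢 μ).submartingale.pos
      have h2 : f = (fun i => μ[Z N | 𝒢 i])⁺ := by
        funext j ω
        exact max_comm _ _
      rw [h2]
      exact h1
    have hfn : 0 ≤ f := fun j ω => le_max_left _ _
    have hset : {ω | ∃ j, (δ : ℝ) ≤ f j ω} = ⋃ n, {ω | (δ : ℝ) ≤
        (Finset.range (n + 1)).sup' Finset.nonempty_range_add_one fun k => f k ω} := by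
      ext ω
      simp only [Set.mem_ofPred_eq, Set.mem_iUnion, Finset.le_sup'_iff, Finset.mem_range]
      constructor
      · rintro ⟨j, hj⟩; exact ⟨j, j, by omega, hj⟩
      · rintro ⟨n, j, _, hj⟩; exact ⟨j, hj⟩
    have hmono : Monotone fun n : ℕ => {ω | (δ : ℝ) ≤
        (Finset.range (n + 1)).sup' Finset.nonempty_range_add_one fun k => f k ω} := by
      intro a b hab ω
      simp only [Set.mem_ofPred_eq, Finset.le_sup'_iff, Finset.mem_range]
      rintro ⟨j, hj, h⟩
      exact ⟨j, by omega, h⟩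
    change δ * μ {ω | ∃ j, (δ : ℝ) ≤ f j ω} ≤ _
    rw [hset, hmono.measure_iUnion, ENNReal.mul_iSup]
    refine iSup_le fun n => (maximal_ineq hsub hfn n).trans ?_
    refine ENNReal.ofReal_le_ofReal ?_
    refine (setIntegral_le_integral (hsub.integrable n) (ae_of_all _ fun ω => hfn n ω)).trans ?_
    have : ∫ ω, f n ω ∂μ = ∫ ω, (μ[Z N | 𝒢 n]) ω ∂μ := by
      refine integral_congr_ae ?_
      have : 0 ≤ᵐ[μ] μ[Z N | 𝒢 n] := condExp_nonneg (ae_of_all _ (hZ0 N))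
      filter_upwards [this] with ω hω
      exact max_eq_right hω
    rw [this, integral_condExp (𝒢.le n)]
  have hgood : ∀ δ : NNReal, 0 < δ → ∀ᵐ ω ∂μ, ∃ N, ∀ j, (μ[Z N | 𝒢 j]) ω < δ := by
    intro δ hδ
    rw [ae_iff]
    have hle : ∀ N, δ * μ {ω | ¬ ∃ N, ∀ j, (μ[Z N | 𝒢 j]) ω < δ} ≤
        ENNReal.ofReal (∫ ω, Z N ω ∂μ) := by
      intro N
      refine le_trans ?_ (hmax N δ hδ)
      refine mul_le_mul_right (measure_mono fun ω hω => ?_) _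
      change ¬ ∃ N, ∀ j, (μ[Z N | 𝒢 j]) ω < δ at hω
      simp only [not_exists, not_forall, not_lt] at hω
      obtain ⟨j, hj⟩ := hω N
      exact ⟨j, hj.trans (le_max_right _ _)⟩
    have h2 := ENNReal.tendsto_ofReal hZint
    rw [ENNReal.ofReal_zero] at h2
    have h3 := ge_of_tendsto' h2 hle
    have h4 := le_antisymm h3 bot_le
    simpa [hδ.ne'] using h4
  have hle : ∀ᵐ ω ∂μ, ∀ N n, N ≤ n → (μ[X n | 𝒢 (r n)]) ω ≤ (μ[Z N | 𝒢 (r n)]) ω := by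
    rw [ae_all_iff]; intro N; rw [ae_all_iff]; intro n
    by_cases h : N ≤ n
    · filter_upwards [condExp_mono (m := 𝒢 (r n)) (hXi n) (hZi N)
        (ae_of_all _ fun ω => hXZ N n ω h)] with ω hω _
      exact hω
    · exact ae_of_all _ fun ω h' => absurd h' h
  have hnn : ∀ᵐ ω ∂μ, ∀ n, 0 ≤ (μ[X n | 𝒢 (r n)]) ω := by
    rw [ae_all_iff]; intro n
    exact condExp_nonneg (ae_of_all _ (h0 n))
  have hgood' : ∀ᵐ ω ∂μ, ∀ i : ℕ, ∃ N, ∀ j, (μ[Z N | 𝒢 j]) ω < ((1 / ((i : NNReal) + 1) : NNReal) : ℝ) := by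
    rw [ae_all_iff]; intro i
    exact hgood _ (by positivity)
  filter_upwards [hle, hnn, hgood'] with ω h1 h2 h3
  rw [Metric.tendsto_atTop]
  intro ε hε
  obtain ⟨i, hi⟩ := exists_nat_one_div_lt hε
  obtain ⟨N, hN⟩ := h3 i
  refine ⟨N, fun n hn => ?_⟩
  rw [Real.dist_0_eq_abs, abs_of_nonneg (h2 n)]
  have := hN (r n)
  push_cast at this
  linarith [h1 N n hn]

/-- one-step estimate. -/
lemma aux_step {Ω : Type*} {m m0 : MeasurableSpace Ω} {μ : Measure Ω} [IsProbabilityMeasure μ]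
    (hm : m ≤ m0) (X : Ω → ℝ) (hX : StronglyMeasurable X) (hX2 : Integrable (fun ω => X ω ^ 2) μ)
    (hX0 : μ[X | m] =ᵐ[μ] 0) (K : ℝ)
    (hvK : ∀ᵐ ω ∂μ, (μ[fun ω => X ω ^ 2 | m]) ω ≤ K) (ε : ℝ) (hε : 0 < ε) (hε1 : ε < 1) (lam : ℝ)
    (P : Ω → ℂ) (hP : StronglyMeasurable[m] P) (c : ℝ) (hPc : ∀ᵐ ω ∂μ, ‖P ω‖ ≤ c) :
    Integrable (fun ω => P ω * (Complex.exp (((lam * X ω : ℝ) : ℂ) * Complex.I) -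
        ((Real.exp (-(lam ^ 2 / 2 * (μ[fun ω => X ω ^ 2 | m]) ω)) : ℝ) : ℂ))) μ ∧
    ∀ᵐ ω ∂μ, ‖(μ[fun ω => P ω * (Complex.exp (((lam * X ω : ℝ) : ℂ) * Complex.I) -
        ((Real.exp (-(lam ^ 2 / 2 * (μ[fun ω => X ω ^ 2 | m]) ω)) : ℝ) : ℂ)) | m]) ω‖ ≤
      c * ((4 * |lam| ^ 3 + 4 * lam ^ 2 + lam ^ 4 * (1 + K)) *
        (ε * (μ[fun ω => X ω ^ 2 | m]) ω + (μ[fun ω' => (X ω') ^ 2 *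
              Set.indicator {ω'' | ε < |X ω''|} (fun _ => (1 : ℝ)) ω' | m]) ω)) := by
  set v : Ω → ℝ := μ[fun ω => X ω ^ 2 | m] with hv
  set Y : Ω → ℝ := fun ω' => (X ω') ^ 2 *
              Set.indicator {ω'' | ε < |X ω''|} (fun _ => (1 : ℝ)) ω' with hY
  have hvm : StronglyMeasurable[m] v := stronglyMeasurable_condExp
  have hvm0 : StronglyMeasurable v := hvm.mono hm
  have hv0 : ∀ᵐ ω ∂μ, 0 ≤ v ω := condExp_nonneg (ae_of_all _ fun ω => sq_nonneg _)
  have hvi : Integrable v μ := integrable_condExp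
  have hXi : Integrable X μ := by
    have : MemLp X 2 μ := (memLp_two_iff_integrable_sq hX.aestronglyMeasurable).2 hX2
    exact this.integrable (by norm_num)
  have hYset : MeasurableSet {ω'' | ε < |X ω''|} :=
    measurableSet_lt measurable_const (hX.measurable.abs)
  have hYX : ∀ ω, 0 ≤ Y ω ∧ Y ω ≤ X ω ^ 2 ∧ X ω ^ 2 ≤ ε ^ 2 + Y ω ∧
      (ε < |X ω| → Y ω = X ω ^ 2) := by
    intro ω
    by_cases h : ε < |X ω|
    · have : Y ω = X ω ^ 2 := by simp [hY, Set.indicator, h]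
      rw [this]
      refine ⟨sq_nonneg _, le_rfl, by nlinarith, fun _ => rfl⟩
    · have : Y ω = 0 := by simp [hY, Set.indicator, h]
      rw [this]
      refine ⟨le_rfl, sq_nonneg _, ?_, fun h' => absurd h' h⟩
      have := not_lt.1 h
      rw [← sq_abs (X ω)]
      nlinarith [abs_nonneg (X ω)]
  have hYm : StronglyMeasurable Y := by
    refine ((hX.measurable.pow_const 2).mul ?_).stronglyMeasurable
    exact measurable_const.indicator hYset
  have hYi : Integrable Y μ := by
    refine hX2.mono' hYm.aestronglyMeasurable (ae_of_all _ fun ω => ?_)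
    rw [Real.norm_of_nonneg (hYX ω).1]; exact (hYX ω).2.1
  set L : Ω → ℝ := μ[Y | m] with hL
  have hL0 : ∀ᵐ ω ∂μ, 0 ≤ L ω := condExp_nonneg (ae_of_all _ fun ω => (hYX ω).1)
  have hvL : ∀ᵐ ω ∂μ, v ω ≤ ε ^ 2 + L ω := by
    have h1 : v ≤ᵐ[μ] μ[(fun _ => ε ^ 2) + Y | m] :=
      condExp_mono hX2 ((integrable_const _).add hYi) (ae_of_all _ fun ω => (hYX ω).2.2.1)
    have h2 := condExp_add (μ := μ) (integrable_const (ε ^ 2)) hYi m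
    rw [condExp_const hm] at h2
    filter_upwards [h1, h2] with ω a b
    rw [b] at a; exact a
  -- the remainder
  set T : Ω → ℂ := fun ω => Complex.exp (((lam * X ω : ℝ) : ℂ) * Complex.I) -
        ((Real.exp (-(lam ^ 2 / 2 * v ω)) : ℝ) : ℂ) with hT
  set T1 : Ω → ℂ := fun ω => X ω • ((lam : ℂ) * Complex.I) with hT1
  set T2 : Ω → ℂ := fun ω => (X ω ^ 2 - v ω) • (-(lam : ℂ) ^ 2 / 2) with hT2
  have hTm : StronglyMeasurable T := by
    refine StronglyMeasurable.sub ?_ ?_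
    · exact (by fun_prop : Continuous fun x : ℝ =>
        Complex.exp (((lam * x : ℝ) : ℂ) * Complex.I)).comp_stronglyMeasurable hX
    · exact (by fun_prop : Continuous fun x : ℝ =>
        ((Real.exp (-(lam ^ 2 / 2 * x)) : ℝ) : ℂ)).comp_stronglyMeasurable hvm0
  have hTi : Integrable T μ := by
    refine Integrable.of_bound hTm.aestronglyMeasurable 2 ?_
    filter_upwards [hv0] with ω h
    refine (norm_sub_le _ _).trans ?_
    rw [Complex.norm_exp_ofReal_mul_I, Complex.norm_real, Real.norm_of_nonneg (Real.exp_pos _).le]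
    have : Real.exp (-(lam ^ 2 / 2 * v ω)) ≤ 1 := Real.exp_le_one_iff.2 (by
      have : 0 ≤ lam ^ 2 / 2 * v ω := by positivity
      linarith)
    linarith
  have hT1i : Integrable T1 μ := hXi.smul_const _
  have hT2i : Integrable T2 μ := (hX2.sub hvi).smul_const _
  have hT10 : μ[T1 | m] =ᵐ[μ] 0 := by
    have := (ContinuousLinearMap.toSpanSingleton ℝ ((lam : ℂ) * Complex.I)).comp_condExp_comm
      (m := m) hXi
    filter_upwards [this, hX0] with ω h1 h2
    have h3 : (⇑(ContinuousLinearMap.toSpanSingleton ℝ ((lam : ℂ) * Complex.I)) ∘ X) = T1 := by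
      funext ω; simp [hT1, ContinuousLinearMap.toSpanSingleton_apply]
    rw [h3] at h1
    rw [← h1]
    simp [h2]
  have hT20 : μ[T2 | m] =ᵐ[μ] 0 := by
    have := (ContinuousLinearMap.toSpanSingleton ℝ (-(lam : ℂ) ^ 2 / 2)).comp_condExp_comm
      (m := m) (hX2.sub hvi)
    have h4 := condExp_sub hX2 hvi m
    have h5 : μ[v | m] = v := condExp_of_stronglyMeasurable hm hvm hvi
    filter_upwards [this, h4] with ω h1 h2
    have h3 : (⇑(ContinuousLinearMap.toSpanSingleton ℝ (-(lam : ℂ) ^ 2 / 2)) ∘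
        ((fun ω => X ω ^ 2) - v)) = T2 := by
      funext ω; simp [hT2, ContinuousLinearMap.toSpanSingleton_apply]
    rw [h3] at h1
    rw [← h1]
    simp only [Function.comp]
    rw [h2, h5]
    simp [hv]
  set R : Ω → ℂ := T - T1 - T2 with hR
  have hRi : Integrable R μ := (hTi.sub hT1i).sub hT2i
  have hRT : μ[T | m] =ᵐ[μ] μ[R | m] := by
    filter_upwards [condExp_sub (hTi.sub hT1i) hT2i m, condExp_sub hTi hT1i m, hT10, hT20]
      with ω h1 h2 h3 h4
    rw [hR, h1]
    simp [h2, h3, h4]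
  set a : ℝ := 4 * |lam| ^ 3 * ε with ha
  set b : ℝ := 4 * lam ^ 2 with hb
  set d : ℝ := lam ^ 4 / 4 with hd
  have ha0 : 0 ≤ a := by positivity
  have hb0 : 0 ≤ b := by positivity
  have hd0 : 0 ≤ d := by positivity
  have hv2i : Integrable (fun ω => v ω ^ 2) μ := by
    refine Integrable.of_bound (hvm0.pow 2).aestronglyMeasurable (K ^ 2) ?_
    filter_upwards [hv0, hvK] with ω h1 h2
    rw [Real.norm_of_nonneg (by positivity)]
    gcongr
  have hRb : ∀ᵐ ω ∂μ, ‖R ω‖ ≤ ((a • fun ω => X ω ^ 2) + (b • Y) + (d • fun ω => v ω ^ 2)) ω := by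
    filter_upwards [hv0] with ω h1
    have e : R ω = (Complex.exp (((lam * X ω : ℝ) : ℂ) * Complex.I) - 1 -
        ((lam * X ω : ℝ) : ℂ) * Complex.I + ((lam * X ω : ℝ) : ℂ) ^ 2 / 2) -
        ((Real.exp (-(lam ^ 2 / 2 * v ω)) - 1 + lam ^ 2 / 2 * v ω : ℝ) : ℂ) := by
      simp only [hR, hT, hT1, hT2, Pi.sub_apply, Complex.real_smul]
      push_cast
      ring
    rw [e]
    refine (norm_sub_le _ _).trans ?_
    simp only [Pi.add_apply, Pi.smul_apply, smul_eq_mul]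
    refine add_le_add ?_ ?_
    · obtain ⟨h3, h4⟩ := aux_exp_I (lam * X ω)
      obtain ⟨y0, y1, y2, y3⟩ := hYX ω
      rcases lt_or_ge ε |X ω| with h | h
      · refine h4.trans ?_
        rw [y3 h]
        have : 0 ≤ a * X ω ^ 2 := by positivity
        rw [hb]; nlinarith
      · refine h3.trans ?_
        have : 0 ≤ b * Y ω := by positivity
        have h6 : |lam * X ω| ^ 3 = |lam| ^ 3 * (|X ω| * X ω ^ 2) := by
          rw [abs_mul, mul_pow, ← sq_abs (X ω)]; ring
        have h7 : |X ω| * X ω ^ 2 ≤ ε * X ω ^ 2 := by gcongr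
        have h8 : |lam| ^ 3 * (|X ω| * X ω ^ 2) ≤ |lam| ^ 3 * (ε * X ω ^ 2) := by gcongr
        rw [h6, ha]; nlinarith
    · rw [Complex.norm_real, Real.norm_eq_abs]
      refine (aux_exp_neg _ (by positivity)).trans (le_of_eq ?_)
      rw [hd]; ring
  have hTb : ∀ᵐ ω ∂μ, ‖(μ[T | m]) ω‖ ≤ a * v ω + b * L ω + d * v ω ^ 2 := by
    have i1 : Integrable (a • fun ω => X ω ^ 2) μ := hX2.smul a
    have i2 : Integrable (b • Y) μ := hYi.smul b
    have i3 : Integrable (d • fun ω => v ω ^ 2) μ := hv2i.smul d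
    have e1 := condExp_mono (m := m) hRi.norm ((i1.add i2).add i3) hRb
    have h5 : μ[fun ω => v ω ^ 2 | m] = fun ω => v ω ^ 2 :=
      condExp_of_stronglyMeasurable hm (hvm.pow 2) hv2i
    filter_upwards [hRT, norm_condExp_le (μ := μ) (m := m) R, e1, condExp_add (i1.add i2) i3 m,
      condExp_add i1 i2 m, condExp_smul (μ := μ) a (fun ω => X ω ^ 2) m, condExp_smul (μ := μ) b Y m,
      condExp_smul (μ := μ) d (fun ω => v ω ^ 2) m] with ω g1 g2 g3 g4 g5 g6 g7 g8
    rw [g1]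
    refine g2.trans (g3.trans (le_of_eq ?_))
    rw [g4, Pi.add_apply, g5, Pi.add_apply, g6, g7, g8, h5]
    rfl
  have hPT : Integrable (fun ω => P ω * T ω) μ :=
    hTi.bdd_mul (hP.mono hm).aestronglyMeasurable hPc
  refine ⟨hPT, ?_⟩
  have hpull := condExp_bilin_of_stronglyMeasurable_left (μ := μ) (ContinuousLinearMap.mul ℝ ℂ) hP
    (g := T) (by simpa using hPT) hTi
  simp only [ContinuousLinearMap.mul_apply'] at hpull
  filter_upwards [hpull, hTb, hPc, hv0, hL0, hvK, hvL] with ω h1 h2 h3 h4 h5 h6 h7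
  rw [h1, norm_mul]
  have hc0 : 0 ≤ c := (norm_nonneg _).trans h3
  refine mul_le_mul h3 (h2.trans ?_) (norm_nonneg _) hc0
  have hv2 : v ω ^ 2 ≤ ε * v ω + K * L ω := by
    have q1 : v ω * v ω ≤ v ω * (ε ^ 2 + L ω) := by gcongr
    have q2 : v ω * L ω ≤ K * L ω := by gcongr
    have q3 : ε ^ 2 * v ω ≤ ε * v ω := by
      gcongr; nlinarith
    nlinarith
  have hK0 : 0 ≤ K := h4.trans h6
  have q4 : d * v ω ^ 2 ≤ lam ^ 4 * (ε * v ω + K * L ω) := by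
    have : lam ^ 4 * v ω ^ 2 ≤ lam ^ 4 * (ε * v ω + K * L ω) := by gcongr
    have : 0 ≤ lam ^ 4 * v ω ^ 2 := by positivity
    rw [hd]; nlinarith
  have r1 : 0 ≤ |lam| ^ 3 * L ω := by positivity
  have r2 : 0 ≤ lam ^ 2 * (ε * v ω) := by positivity
  have r3 : 0 ≤ lam ^ 4 * (K * (ε * v ω)) := by positivity
  have r4 : 0 ≤ lam ^ 4 * L ω := by positivity
  rw [ha, hb]
  nlinarith

/-- non-asymptotic estimate for martingales with bounded conditional variance. -/
lemma aux_core {Ω : Type*} {m0 : MeasurableSpace Ω} {μ : Measure Ω} [IsProbabilityMeasure μ]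
    (ℱ : Filtration ℕ m0) (X : ℕ → Ω → ℝ) (N : ℕ) (sl : ℝ) (hsl : 0 ≤ sl)
    (hX : ∀ k, StronglyMeasurable[ℱ (k + 1)] (X k))
    (hX2 : ∀ k, Integrable (fun ω => X k ω ^ 2) μ)
    (hX0 : ∀ k, μ[X k | ℱ k] =ᵐ[μ] 0) (K : ℝ) (hslK : sl ≤ K)
    (hVK : ∀ᵐ ω ∂μ, ∑ k ∈ Finset.range N, (μ[fun ω => X k ω ^ 2 | ℱ k]) ω ≤ K)
    (ε : ℝ) (hε : 0 < ε) (hε1 : ε < 1) (lam : ℝ) (C : ℝ)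
    (hC : C = Real.exp (lam ^ 2 / 2 * K) *
      (4 * |lam| ^ 3 + 4 * lam ^ 2 + lam ^ 4 * (1 + K))) :
    ∀ᵐ ω ∂μ, ‖(μ[fun ω => Complex.exp
          (((lam * ∑ k ∈ Finset.range N, X k ω : ℝ) : ℂ) * Complex.I) | ℱ 0]) ω -
          ((Real.exp (-(sl * lam ^ 2) / 2) : ℝ) : ℂ)‖ ≤
      (μ[fun ω => C * (ε * ∑ k ∈ Finset.range N, (μ[fun ω => X k ω ^ 2 | ℱ k]) ω +
        ∑ k ∈ Finset.range N, (μ[fun ω' => (X k ω') ^ 2 *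
              Set.indicator {ω'' | ε < |X k ω''|} (fun _ => (1 : ℝ)) ω' | ℱ k]) ω +
        |∑ k ∈ Finset.range N, (μ[fun ω => X k ω ^ 2 | ℱ k]) ω - sl|) | ℱ 0]) ω := by
  set v : ℕ → Ω → ℝ := fun k => μ[fun ω => X k ω ^ 2 | ℱ k] with hv
  set L : ℕ → Ω → ℝ := fun k => μ[fun ω' => (X k ω') ^ 2 *
              Set.indicator {ω'' | ε < |X k ω''|} (fun _ => (1 : ℝ)) ω' | ℱ k] with hL
  set V : Ω → ℝ := fun ω => ∑ k ∈ Finset.range N, v k ω with hV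
  have hK0 : 0 ≤ K := hsl.trans hslK
  have hvm : ∀ k, StronglyMeasurable[ℱ k] (v k) := fun k => stronglyMeasurable_condExp
  have hv0 : ∀ᵐ ω ∂μ, ∀ k, 0 ≤ v k ω := by
    rw [ae_all_iff]; intro k
    exact condExp_nonneg (ae_of_all _ fun ω => sq_nonneg _)
  have hvi : ∀ k, Integrable (v k) μ := fun k => integrable_condExp
  have hLi : ∀ k, Integrable (L k) μ := fun k => integrable_condExp
  have hpart : ∀ᵐ ω ∂μ, ∀ k, k ≤ N → ∑ j ∈ Finset.range k, v j ω ≤ K := by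
    filter_upwards [hv0, hVK] with ω h1 h2 k hk
    refine le_trans (Finset.sum_le_sum_of_subset_of_nonneg ?_ fun i _ _ => h1 i) h2
    exact Finset.range_subset_range.2 hk
  set c : ℝ := Real.exp (lam ^ 2 / 2 * K) with hc
  set A : ℝ := 4 * |lam| ^ 3 + 4 * lam ^ 2 + lam ^ 4 * (1 + K) with hA
  set Z : ℕ → Ω → ℂ := fun k ω => Complex.exp
    (((lam * ∑ j ∈ Finset.range k, X j ω : ℝ) : ℂ) * Complex.I +
      ((lam ^ 2 / 2 * ∑ j ∈ Finset.range k, v j ω : ℝ) : ℂ)) with hZ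
  set P : ℕ → Ω → ℂ := fun k ω => Complex.exp
    (((lam * ∑ j ∈ Finset.range k, X j ω : ℝ) : ℂ) * Complex.I +
      ((lam ^ 2 / 2 * ∑ j ∈ Finset.range (k + 1), v j ω : ℝ) : ℂ)) with hP
  have hsumX : ∀ k, StronglyMeasurable[ℱ k] (fun ω => ∑ j ∈ Finset.range k, X j ω) := by
    intro k
    refine Finset.stronglyMeasurable_fun_sum _ fun j hj => ?_
    exact (hX j).mono (ℱ.mono (by have := Finset.mem_range.1 hj; omega))
  have hsumv : ∀ k, StronglyMeasurable[ℱ k] (fun ω => ∑ j ∈ Finset.range (k + 1), v j ω) := by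
    intro k
    refine Finset.stronglyMeasurable_fun_sum _ fun j hj => ?_
    exact (hvm j).mono (ℱ.mono (by have := Finset.mem_range.1 hj; omega))
  have hPm : ∀ k, StronglyMeasurable[ℱ k] (P k) := by
    intro k
    exact (by fun_prop : Continuous fun p : ℝ × ℝ => Complex.exp
      (((lam * p.1 : ℝ) : ℂ) * Complex.I + ((lam ^ 2 / 2 * p.2 : ℝ) : ℂ))).comp_stronglyMeasurable
      ((hsumX k).prodMk (hsumv k))
  have hPc : ∀ k, k < N → ∀ᵐ ω ∂μ, ‖P k ω‖ ≤ c := by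
    intro k hk
    filter_upwards [hpart] with ω h
    have := h (k + 1) hk
    simp only [hP]
    rw [Complex.exp_add, norm_mul, Complex.norm_exp_ofReal_mul_I, one_mul,
      Complex.norm_exp, Complex.ofReal_re, hc]
    gcongr
  set W : ℕ → Ω → ℂ := fun k ω => P k ω * (Complex.exp (((lam * X k ω : ℝ) : ℂ) * Complex.I) -
        ((Real.exp (-(lam ^ 2 / 2 * v k ω)) : ℝ) : ℂ)) with hW
  have hstep : ∀ k, k < N → Integrable (W k) μ ∧
      ∀ᵐ ω ∂μ, ‖(μ[W k | ℱ k]) ω‖ ≤ c * (A * (ε * v k ω + L k ω)) := by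
    intro k hk
    refine aux_step (ℱ.le k) (X k) ((hX k).mono (ℱ.le _)) (hX2 k) (hX0 k) K ?_ ε hε hε1 lam
      (P k) (hPm k) c (hPc k hk)
    filter_upwards [hpart, hv0] with ω h1 h2
    have := h1 (k + 1) hk
    rw [Finset.sum_range_succ] at this
    have h3 : 0 ≤ ∑ j ∈ Finset.range k, v j ω := Finset.sum_nonneg fun j _ => h2 j
    change v k ω ≤ K
    linarith
  have hWZ : ∀ k ω, W k ω = Z (k + 1) ω - Z k ω := by
    intro k ω
    simp only [hW, hP, hZ, mul_sub, Complex.ofReal_exp, ← Complex.exp_add, Finset.sum_range_succ]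
    congr 2 <;> (push_cast; ring)
  have hWsum : ∀ ω, ∑ k ∈ Finset.range N, W k ω = Z N ω - 1 := by
    intro ω
    simp only [hWZ]
    rw [Finset.sum_range_sub (fun k => Z k ω)]
    simp [hZ]
  set β : ℕ → Ω → ℝ := fun k ω => c * (A * (ε * v k ω + L k ω)) with hβ
  have hβi : ∀ k, Integrable (β k) μ := fun k =>
    ((((hvi k).const_mul ε).add (hLi k)).const_mul A).const_mul c
  have hW0 : ∀ᵐ ω ∂μ, ∀ k, k < N → ‖(μ[W k | ℱ 0]) ω‖ ≤ (μ[β k | ℱ 0]) ω := by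
    rw [ae_all_iff]; intro k
    by_cases hk : k < N
    · obtain ⟨h1, h2⟩ := hstep k hk
      have h3 := condExp_condExp_of_le (μ := μ) (f := W k) (ℱ.mono (Nat.zero_le k)) (ℱ.le k)
      have h4 := norm_condExp_le (μ := μ) (m := ℱ 0) (μ[W k | ℱ k])
      have h5 := condExp_mono (m := ℱ 0) (integrable_condExp (μ := μ) (m := ℱ k) (f := W k)).norm
        (hβi k) h2
      filter_upwards [h3, h4, h5] with ω g3 g4 g5 _
      rw [← g3]
      exact g4.trans g5
    · exact ae_of_all _ fun ω h => absurd h hk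
  have hWi : ∀ k ∈ Finset.range N, Integrable (W k) μ := fun k hk =>
    (hstep k (Finset.mem_range.1 hk)).1
  set e0 : ℝ := Real.exp (-(sl * lam ^ 2) / 2) with he0
  have he01 : e0 ≤ 1 := Real.exp_le_one_iff.2 (by
    have : 0 ≤ sl * lam ^ 2 := by positivity
    linarith)
  have he00 : 0 < e0 := Real.exp_pos _
  set E : Ω → ℂ := fun ω => Complex.exp
          (((lam * ∑ k ∈ Finset.range N, X k ω : ℝ) : ℂ) * Complex.I) with hE
  have hEm : StronglyMeasurable E :=
    (by fun_prop : Continuous fun x : ℝ =>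
        Complex.exp (((lam * x : ℝ) : ℂ) * Complex.I)).comp_stronglyMeasurable
        ((hsumX N).mono (ℱ.le N))
  have hEi : Integrable E μ :=
    Integrable.of_bound hEm.aestronglyMeasurable 1 (ae_of_all _ fun ω => by
      simp only [hE]; rw [Complex.norm_exp_ofReal_mul_I])
  set S : Ω → ℂ := ∑ k ∈ Finset.range N, W k with hS
  have hSi : Integrable S μ := integrable_finsetSum' _ hWi
  set Q : Ω → ℂ := (E - fun _ => (e0 : ℂ)) - (e0 : ℂ) • S with hQ
  have hE0i : Integrable (E - fun _ => (e0 : ℂ)) μ := hEi.sub (integrable_const _)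
  have hQi : Integrable Q μ := hE0i.sub (hSi.smul _)
  have hVi : Integrable V μ := integrable_finsetSum _ fun k _ => hvi k
  have hAbsi : Integrable (fun ω => C * |V ω - sl|) μ :=
    ((hVi.sub (integrable_const sl)).abs).const_mul C
  have hA1 : lam ^ 2 / 2 ≤ A := by
    have : 0 ≤ |lam| ^ 3 := by positivity
    have : 0 ≤ lam ^ 4 * (1 + K) := by positivity
    have := sq_nonneg lam
    rw [hA]; linarith
  have hA0 : 0 ≤ A := by positivity
  have hc0 : 0 < c := Real.exp_pos _
  have hQb : ∀ᵐ ω ∂μ, ‖Q ω‖ ≤ C * |V ω - sl| := by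
    filter_upwards [hVK, hv0] with ω h1 h2
    have hV0 : 0 ≤ V ω := Finset.sum_nonneg fun j _ => h2 j
    have hVK' : V ω ≤ K := h1
    have hSω : S ω = Z N ω - 1 := by rw [hS, Finset.sum_apply, hWsum]
    have hez : (e0 : ℂ) * Z N ω = E ω * ((Real.exp (lam ^ 2 / 2 * (V ω - sl)) : ℝ) : ℂ) := by
      simp only [hZ, hE, he0, hV, Complex.ofReal_exp, ← Complex.exp_add]
      congr 1
      push_cast
      ring
    have hQω : Q ω = E ω * ((1 - Real.exp (lam ^ 2 / 2 * (V ω - sl)) : ℝ) : ℂ) := by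
      simp only [hQ, Pi.sub_apply, Pi.smul_apply, smul_eq_mul, hSω]
      rw [mul_sub, hez]
      push_cast
      ring
    rw [hQω, norm_mul, Complex.norm_exp_ofReal_mul_I, one_mul, Complex.norm_real, Real.norm_eq_abs]
    refine (aux_exp_abs _).trans ?_
    have hab : |V ω - sl| ≤ K := by rw [abs_le]; constructor <;> linarith
    have h3 : |lam ^ 2 / 2 * (V ω - sl)| = lam ^ 2 / 2 * |V ω - sl| := by
      rw [abs_mul, abs_of_nonneg (by positivity : 0 ≤ lam ^ 2 / 2)]
    rw [h3, hC]
    have h4 : Real.exp (lam ^ 2 / 2 * |V ω - sl|) ≤ c := by rw [hc]; gcongr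
    calc lam ^ 2 / 2 * |V ω - sl| * Real.exp (lam ^ 2 / 2 * |V ω - sl|)
        ≤ A * |V ω - sl| * c := by gcongr
      _ = c * A * |V ω - sl| := by ring
  have hQ0 := condExp_mono (m := ℱ 0) hQi.norm hAbsi hQb
  have hfin : (fun ω => C * (ε * ∑ k ∈ Finset.range N, v k ω + ∑ k ∈ Finset.range N, L k ω +
        |∑ k ∈ Finset.range N, v k ω - sl|)) =
      (∑ k ∈ Finset.range N, β k) + fun ω => C * |V ω - sl| := by
    funext ω
    simp only [hβ, Pi.add_apply, Finset.sum_apply, ← Finset.mul_sum, Finset.sum_add_distrib, hC, hV]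
    ring
  have hβsi : Integrable (∑ k ∈ Finset.range N, β k) μ := integrable_finsetSum' _ fun k _ => hβi k
  have f1 := condExp_add hβsi hAbsi (ℱ 0)
  have f2 := condExp_finsetSum (μ := μ) (s := Finset.range N) (f := β) (fun k _ => hβi k) (ℱ 0)
  have f3 := condExp_finsetSum (μ := μ) hWi (ℱ 0)
  have f4 := condExp_sub hE0i (hSi.smul (e0 : ℂ)) (ℱ 0)
  have f5 := condExp_smul (μ := μ) (e0 : ℂ) S (ℱ 0)
  have f6 := condExp_sub hEi (integrable_const (e0 : ℂ)) (ℱ 0)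
  rw [condExp_const (ℱ.le 0)] at f6
  rw [hfin]
  filter_upwards [f1, f2, f3, f4, f5, f6, hQ0, norm_condExp_le (μ := μ) (m := ℱ 0) Q, hW0]
    with ω g1 g2 g3 g4 g5 g6 g7 g8 g9
  rw [g1, Pi.add_apply, g2, Finset.sum_apply]
  have hEq : (μ[E | ℱ 0]) ω - (e0 : ℂ) = (e0 : ℂ) * (μ[S | ℱ 0]) ω + (μ[Q | ℱ 0]) ω := by
    have g4' : (μ[Q | ℱ 0]) ω = _ := g4
    rw [g4', Pi.sub_apply, g5, g6]
    simp
  rw [hEq]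
  refine (norm_add_le _ _).trans (add_le_add ?_ (g8.trans g7))
  rw [norm_mul, Complex.norm_real, Real.norm_of_nonneg he00.le]
  refine (mul_le_of_le_one_left (norm_nonneg _) he01).trans ?_
  rw [g3, Finset.sum_apply]
  refine (norm_sum_le _ _).trans (Finset.sum_le_sum fun k hk => g9 k (Finset.mem_range.1 hk))

/-- pointwise bound for stopped sums. -/
lemma aux_stop (v : ℕ → ℝ) (hv : ∀ k, 0 ≤ v k) (K : ℝ) (hK : 0 ≤ K) (N : ℕ) :
    ∑ k ∈ Finset.range N, (if ∑ j ∈ Finset.range (k + 1), v j ≤ K then v k else 0) ≤ K := by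
  have key : ∀ N, ∑ k ∈ Finset.range N,
      (if ∑ j ∈ Finset.range (k + 1), v j ≤ K then v k else 0) ≤
        min K (∑ j ∈ Finset.range N, v j) := by
    intro N
    induction N with
    | zero => simpa using hK
    | succ n ih =>
      rw [Finset.sum_range_succ _ n]
      have h1 := le_min_iff.1 ih
      have h2 := hv n
      split_ifs with h
      · rw [min_eq_right h, Finset.sum_range_succ _ n]
        linarith [h1.2]
      · rw [min_eq_left (not_le.1 h).le]
        linarith [h1.1]
  exact (key N).trans (min_le_left _ _)

/-- non-asymptotic estimate after truncation. -/
lemma aux_trunc {Ω : Type*} {m0 : MeasurableSpace Ω} {μ : Measure Ω} [IsProbabilityMeasure μ]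
    (ℱ : Filtration ℕ m0) (X : ℕ → Ω → ℝ) (N : ℕ) (sl : ℝ) (hsl : 0 ≤ sl)
    (hX : ∀ k, StronglyMeasurable[ℱ (k + 1)] (X k))
    (hX2 : ∀ k, Integrable (fun ω => X k ω ^ 2) μ)
    (hX0 : ∀ k, μ[X k | ℱ k] =ᵐ[μ] 0) (K : ℝ) (hslK : K = sl + 1)
    (ε : ℝ) (hε : 0 < ε) (hε1 : ε < 1) (lam : ℝ) (C : ℝ)
    (hC : C = Real.exp (lam ^ 2 / 2 * K) *
      (4 * |lam| ^ 3 + 4 * lam ^ 2 + lam ^ 4 * (1 + K))) :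
    ∀ᵐ ω ∂μ, ‖(μ[fun ω => Complex.exp
          (((lam * ∑ k ∈ Finset.range N, X k ω : ℝ) : ℂ) * Complex.I) | ℱ 0]) ω -
          ((Real.exp (-(sl * lam ^ 2) / 2) : ℝ) : ℂ)‖ ≤
      C * (K + 1) * ε + C * (μ[fun ω => max 0 (min K
        (∑ k ∈ Finset.range N, (μ[fun ω' => (X k ω') ^ 2 *
              Set.indicator {ω'' | ε < |X k ω''|} (fun _ => (1 : ℝ)) ω' | ℱ k]) ω)) | ℱ 0]) ω +
      (2 + C * K) * (μ[Set.indicator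
              {ω' | ε < |(∑ k ∈ Finset.range N, (μ[fun ω => X k ω ^ 2 | ℱ k]) ω') - sl|}
              (fun _ => (1 : ℝ)) | ℱ 0]) ω := by
  set v : ℕ → Ω → ℝ := fun k => μ[fun ω => X k ω ^ 2 | ℱ k] with hv
  set Y : ℕ → Ω → ℝ := fun k ω' => (X k ω') ^ 2 *
              Set.indicator {ω'' | ε < |X k ω''|} (fun _ => (1 : ℝ)) ω' with hY
  set L : ℕ → Ω → ℝ := fun k => μ[Y k | ℱ k] with hL
  set V : Ω → ℝ := fun ω => ∑ k ∈ Finset.range N, v k ω with hV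
  set Λ : Ω → ℝ := fun ω => ∑ k ∈ Finset.range N, L k ω with hΛ
  have hK0 : 0 ≤ K := by linarith
  have hC0 : 0 ≤ C := by rw [hC]; positivity
  have hvm : ∀ k, StronglyMeasurable[ℱ k] (v k) := fun k => stronglyMeasurable_condExp
  have hv0 : ∀ᵐ ω ∂μ, ∀ k, 0 ≤ v k ω := by
    rw [ae_all_iff]; intro k
    exact condExp_nonneg (ae_of_all _ fun ω => sq_nonneg _)
  have hXm0 : ∀ k, StronglyMeasurable (X k) := fun k => (hX k).mono (ℱ.le _)
  have hXi : ∀ k, Integrable (X k) μ := by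
    intro k
    have : MemLp (X k) 2 μ := (memLp_two_iff_integrable_sq (hXm0 k).aestronglyMeasurable).2 (hX2 k)
    exact this.integrable (by norm_num)
  have hY0 : ∀ k ω, 0 ≤ Y k ω := fun k ω =>
    mul_nonneg (sq_nonneg _) (Set.indicator_nonneg (fun _ _ => zero_le_one) _)
  have hYX : ∀ k ω, Y k ω ≤ X k ω ^ 2 := by
    intro k ω
    refine mul_le_of_le_one_right (sq_nonneg _) ?_
    exact Set.indicator_le' (fun _ _ => le_rfl) (fun _ _ => zero_le_one) ω
  have hYi : ∀ k, Integrable (Y k) μ := by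
    intro k
    refine (hX2 k).mono' (((hXm0 k).measurable.pow_const 2).mul (measurable_const.indicator
      (measurableSet_lt measurable_const (hXm0 k).measurable.abs))).aestronglyMeasurable
      (ae_of_all _ fun ω => ?_)
    rw [Real.norm_of_nonneg (hY0 k ω)]; exact hYX k ω
  have hL0 : ∀ᵐ ω ∂μ, ∀ k, 0 ≤ L k ω := by
    rw [ae_all_iff]; intro k
    exact condExp_nonneg (ae_of_all _ fun ω => hY0 k ω)
  have hLv : ∀ᵐ ω ∂μ, ∀ k, L k ω ≤ v k ω := by
    rw [ae_all_iff]; intro k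
    exact condExp_mono (hYi k) (hX2 k) (ae_of_all _ fun ω => hYX k ω)
  set B : ℕ → Set Ω := fun k => {ω | ∑ j ∈ Finset.range (k + 1), v j ω ≤ K} with hB
  have hBm : ∀ k, MeasurableSet[ℱ k] (B k) := by
    intro k
    have : StronglyMeasurable[ℱ k] (fun ω => ∑ j ∈ Finset.range (k + 1), v j ω) :=
      Finset.stronglyMeasurable_fun_sum _ fun j hj =>
        (hvm j).mono (ℱ.mono (by have := Finset.mem_range.1 hj; omega))
    exact measurableSet_le this.measurable measurable_const
  set X' : ℕ → Ω → ℝ := fun k => (B k).indicator (X k) with hX'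
  have hsq : ∀ k, (fun ω => X' k ω ^ 2) = (B k).indicator (fun ω => X k ω ^ 2) := by
    intro k; funext ω
    by_cases h : ω ∈ B k <;> simp [hX', h]
  have hYe : ∀ k, (fun ω' => (X' k ω') ^ 2 *
              Set.indicator {ω'' | ε < |X' k ω''|} (fun _ => (1 : ℝ)) ω') =
      (B k).indicator (Y k) := by
    intro k; funext ω
    by_cases h : ω ∈ B k <;> simp [hX', hY, h, Set.indicator]
  have hX'm : ∀ k, StronglyMeasurable[ℱ (k + 1)] (X' k) := fun k =>
    (hX k).indicator (ℱ.mono (Nat.le_succ k) _ (hBm k))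
  have hX'2 : ∀ k, Integrable (fun ω => X' k ω ^ 2) μ := by
    intro k; rw [hsq k]
    exact (hX2 k).indicator (ℱ.le k _ (hBm k))
  have hX'0 : ∀ k, μ[X' k | ℱ k] =ᵐ[μ] 0 := by
    intro k
    filter_upwards [condExp_indicator (hXi k) (hBm k), hX0 k] with ω h1 h2
    rw [h1]
    by_cases h : ω ∈ B k <;> simp [h, h2]
  have hv' : ∀ᵐ ω ∂μ, ∀ k, (μ[fun ω => X' k ω ^ 2 | ℱ k]) ω =
      if ∑ j ∈ Finset.range (k + 1), v j ω ≤ K then v k ω else 0 := by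
    rw [ae_all_iff]; intro k
    rw [hsq k]
    filter_upwards [condExp_indicator (hX2 k) (hBm k)] with ω h1
    rw [h1]; rfl
  have hL' : ∀ᵐ ω ∂μ, ∀ k, (μ[fun ω' => (X' k ω') ^ 2 *
              Set.indicator {ω'' | ε < |X' k ω''|} (fun _ => (1 : ℝ)) ω' | ℱ k]) ω =
      if ∑ j ∈ Finset.range (k + 1), v j ω ≤ K then L k ω else 0 := by
    rw [ae_all_iff]; intro k
    rw [hYe k]
    filter_upwards [condExp_indicator (hYi k) (hBm k)] with ω h1
    rw [h1]; rfl
  have hV'K : ∀ᵐ ω ∂μ, ∑ k ∈ Finset.range N, (μ[fun ω => X' k ω ^ 2 | ℱ k]) ω ≤ K := by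
    filter_upwards [hv', hv0] with ω h1 h2
    simp only [h1]
    exact aux_stop (fun k => v k ω) h2 K hK0 N
  have hcore := aux_core ℱ X' N sl hsl hX'm hX'2 hX'0 K (by linarith) hV'K ε hε hε1 lam C hC
  set Ind : Ω → ℝ := Set.indicator {ω' | ε < |V ω' - sl|} (fun _ => (1 : ℝ)) with hInd
  set G : Ω → ℝ := fun ω => max 0 (min K (Λ ω)) with hG
  have hVm : Measurable V := Finset.measurable_fun_sum _ fun k _ =>
    ((hvm k).mono (ℱ.le k)).measurable
  have hΛm : Measurable Λ := Finset.measurable_fun_sum _ fun k _ =>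
    ((stronglyMeasurable_condExp (μ := μ) (m := ℱ k) (f := Y k)).mono (ℱ.le k)).measurable
  have hIm : Measurable Ind := measurable_const.indicator
    (measurableSet_lt measurable_const (hVm.sub_const sl).abs)
  have hGm : Measurable G := measurable_const.max (measurable_const.min hΛm)
  have hIi : Integrable Ind μ := Integrable.of_bound hIm.aestronglyMeasurable 1
    (ae_of_all _ fun ω => by
      simp only [hInd, Set.indicator]; split_ifs <;> simp)
  have hGi : Integrable G μ := Integrable.of_bound hGm.aestronglyMeasurable K
    (ae_of_all _ fun ω => by
      rw [Real.norm_of_nonneg (le_max_left _ _)]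
      exact max_le hK0 (min_le_left _ _))
  -- pointwise facts on the good event
  have hgood : ∀ᵐ ω ∂μ, V ω ≤ K → ∀ k, k < N → ∑ j ∈ Finset.range (k + 1), v j ω ≤ K := by
    filter_upwards [hv0] with ω h0 h k hk
    refine le_trans (Finset.sum_le_sum_of_subset_of_nonneg ?_ fun i _ _ => h0 i) h
    exact Finset.range_subset_range.2 hk
  have hIc : ∀ ω, (Ind ω = 1) ∨ (Ind ω = 0 ∧ |V ω - sl| ≤ ε ∧ V ω ≤ K) := by
    intro ω
    by_cases h : ε < |V ω - sl|
    · left; simp [hInd, Set.indicator, h]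
    · right
      refine ⟨by simp [hInd, Set.indicator, h], not_lt.1 h, ?_⟩
      have := (abs_le.1 (not_lt.1 h)).2
      linarith
  set E : Ω → ℂ := fun ω => Complex.exp
          (((lam * ∑ k ∈ Finset.range N, X k ω : ℝ) : ℂ) * Complex.I) with hE
  set E' : Ω → ℂ := fun ω => Complex.exp
          (((lam * ∑ k ∈ Finset.range N, X' k ω : ℝ) : ℂ) * Complex.I) with hE'
  have hcont : Continuous fun x : ℝ => Complex.exp (((lam * x : ℝ) : ℂ) * Complex.I) := by fun_prop
  have hEi : Integrable E μ := by
    refine Integrable.of_bound (hcont.comp_stronglyMeasurable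
      (Finset.stronglyMeasurable_fun_sum _ fun k _ => hXm0 k)).aestronglyMeasurable 1
      (ae_of_all _ fun ω => ?_)
    rw [Complex.norm_exp_ofReal_mul_I]
  have hE'i : Integrable E' μ := by
    refine Integrable.of_bound (hcont.comp_stronglyMeasurable
      (Finset.stronglyMeasurable_fun_sum _ fun k _ =>
        (hX'm k).mono (ℱ.le _))).aestronglyMeasurable 1
      (ae_of_all _ fun ω => ?_)
    rw [Complex.norm_exp_ofReal_mul_I]
  have hdiff : ∀ᵐ ω ∂μ, ‖(E - E') ω‖ ≤ ((2 : ℝ) • Ind) ω := by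
    filter_upwards [hgood] with ω hg
    rw [Pi.sub_apply, Pi.smul_apply, smul_eq_mul]
    rcases hIc ω with h | ⟨h, _, h2⟩
    · rw [h]
      refine (norm_sub_le _ _).trans ?_
      simp only [hE, hE']
      rw [Complex.norm_exp_ofReal_mul_I, Complex.norm_exp_ofReal_mul_I]; norm_num
    · have : E ω = E' ω := by
        simp only [hE, hE']
        congr 4
        refine Finset.sum_congr rfl fun k hk => ?_
        have : ω ∈ B k := hg h2 k (Finset.mem_range.1 hk)
        simp [hX', this]
      rw [this, h]; simp
  have d1 := condExp_mono (m := ℱ 0) (hEi.sub hE'i).norm (hIi.smul (2 : ℝ)) hdiff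
  have d2 := norm_condExp_le (μ := μ) (m := ℱ 0) (E - E')
  have d3 := condExp_sub hEi hE'i (ℱ 0)
  have d4 := condExp_smul (μ := μ) (2 : ℝ) Ind (ℱ 0)
  -- bound on the right-hand side of the core estimate
  have hrhs : ∀ᵐ ω ∂μ, C * (ε * ∑ k ∈ Finset.range N, (μ[fun ω => X' k ω ^ 2 | ℱ k]) ω +
        ∑ k ∈ Finset.range N, (μ[fun ω' => (X' k ω') ^ 2 *
              Set.indicator {ω'' | ε < |X' k ω''|} (fun _ => (1 : ℝ)) ω' | ℱ k]) ω +
        |∑ k ∈ Finset.range N, (μ[fun ω => X' k ω ^ 2 | ℱ k]) ω - sl|) ≤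
      ((fun _ : Ω => C * (K + 1) * ε : Ω → ℝ) + C • G + (C * K) • Ind) ω := by
    filter_upwards [hgood, hv', hL', hv0, hL0, hLv, hV'K] with ω hg h1 h2 h3 h4 h5 h6
    have hV0 : 0 ≤ ∑ k ∈ Finset.range N, (μ[fun ω => X' k ω ^ 2 | ℱ k]) ω := by
      refine Finset.sum_nonneg fun k _ => ?_
      rw [h1]; split_ifs
      · exact h3 k
      · exact le_rfl
    have hLam : ∑ k ∈ Finset.range N, (μ[fun ω' => (X' k ω') ^ 2 *
              Set.indicator {ω'' | ε < |X' k ω''|} (fun _ => (1 : ℝ)) ω' | ℱ k]) ω ≤ G ω := by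
      refine le_trans (le_min ?_ ?_) (le_max_right _ _)
      · refine le_trans (Finset.sum_le_sum fun k _ => ?_) h6
        rw [h1, h2]; split_ifs
        · exact h5 k
        · exact le_rfl
      · refine Finset.sum_le_sum fun k _ => ?_
        rw [h2]; split_ifs
        · exact le_rfl
        · exact h4 k
    have habs : |∑ k ∈ Finset.range N, (μ[fun ω => X' k ω ^ 2 | ℱ k]) ω - sl| ≤
        ε + K * Ind ω := by
      rcases hIc ω with h | ⟨h, h7, h8⟩
      · rw [h, abs_le]; constructor <;> linarith
      · have : ∑ k ∈ Finset.range N, (μ[fun ω => X' k ω ^ 2 | ℱ k]) ω = V ω := by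
          refine Finset.sum_congr rfl fun k hk => ?_
          rw [h1, if_pos (hg h8 k (Finset.mem_range.1 hk))]
        rw [this, h]; linarith
    simp only [Pi.add_apply, Pi.smul_apply, smul_eq_mul]
    have h9 : ε * ∑ k ∈ Finset.range N, (μ[fun ω => X' k ω ^ 2 | ℱ k]) ω ≤ ε * K := by gcongr
    calc _ ≤ C * (ε * K + G ω + (ε + K * Ind ω)) := by gcongr
      _ = _ := by ring
  have hconsti : Integrable (fun _ : Ω => C * (K + 1) * ε) μ := integrable_const _
  have hsumi := (hconsti.add (hGi.smul C)).add (hIi.smul (C * K))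
  have hrm : Integrable (fun ω => C * (ε * ∑ k ∈ Finset.range N,
        (μ[fun ω => X' k ω ^ 2 | ℱ k]) ω +
        ∑ k ∈ Finset.range N, (μ[fun ω' => (X' k ω') ^ 2 *
              Set.indicator {ω'' | ε < |X' k ω''|} (fun _ => (1 : ℝ)) ω' | ℱ k]) ω +
        |∑ k ∈ Finset.range N, (μ[fun ω => X' k ω ^ 2 | ℱ k]) ω - sl|)) μ := by
    have i1 : Integrable (fun ω => ∑ k ∈ Finset.range N, (μ[fun ω => X' k ω ^ 2 | ℱ k]) ω) μ :=
      integrable_finsetSum _ fun k _ => integrable_condExp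
    have i2 : Integrable (fun ω => ∑ k ∈ Finset.range N, (μ[fun ω' => (X' k ω') ^ 2 *
              Set.indicator {ω'' | ε < |X' k ω''|} (fun _ => (1 : ℝ)) ω' | ℱ k]) ω) μ :=
      integrable_finsetSum _ fun k _ => integrable_condExp
    exact (((i1.const_mul ε).add i2).add (i1.sub (integrable_const sl)).abs).const_mul C
  have c1 := condExp_mono (m := ℱ 0) hrm hsumi hrhs
  have c2 := condExp_add (hconsti.add (hGi.smul C)) (hIi.smul (C * K)) (ℱ 0)
  have c3 := condExp_add hconsti (hGi.smul C) (ℱ 0)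
  rw [condExp_const (ℱ.le 0)] at c3
  have c4 := condExp_smul (μ := μ) C G (ℱ 0)
  have c5 := condExp_smul (μ := μ) (C * K) Ind (ℱ 0)
  filter_upwards [hcore, d1, d2, d3, d4, c1, c2, c3, c4, c5]
    with ω h0 e1 e2 e3 e4 g1 g2 g3 g4 g5
  have t1 : ‖(μ[E | ℱ 0]) ω - (μ[E' | ℱ 0]) ω‖ ≤ 2 * (μ[Ind | ℱ 0]) ω := by
    rw [e3] at e2
    rw [e4] at e1
    exact e2.trans e1
  have t2 := h0.trans g1
  rw [g2, Pi.add_apply, g3, Pi.add_apply, g4, g5] at t2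
  simp only [Pi.smul_apply, smul_eq_mul] at t2
  refine (norm_sub_le_norm_sub_add_norm_sub _ ((μ[E' | ℱ 0]) ω) _).trans ?_
  refine (add_le_add t1 t2).trans (le_of_eq ?_)
  ring

/-- conditional martingale CLT, version with conditional-probability
convergence of the conditional variances, Proposition B.2 of the paper. Same setting as
the conditional CLT, but with hypothesis (d'): for every `ε ∈ (0,1)`, a.s.
`E[ 1{|V_{n,s_n} - sl| > ε} | ℱ n 0] → 0`, where `V_{n,k} = ∑_{j=1}^k E[D_{n,j}² | ℱ n (j-1)]`. -/
theorem stmt2 {Ω : Type*} {m0 : MeasurableSpace Ω} {μ : Measure Ω} [IsProbabilityMeasure μ]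
    (ℱ : ℕ → Filtration ℕ m0) (D : ℕ → ℕ → Ω → ℝ) (s : ℕ → ℕ) (sl : ℝ) (hsl : 0 ≤ sl)
    (ha_meas : ∀ n k, 1 ≤ k → StronglyMeasurable[(ℱ n) k] (D n k))
    (ha_int : ∀ n k, 1 ≤ k → Integrable (fun ω => (D n k ω) ^ 2) μ)
    (ha_mart : ∀ n k, 1 ≤ k → μ[D n k | (ℱ n) (k - 1)] =ᵐ[μ] 0)
    (𝒢 : Filtration ℕ m0) (r : ℕ → ℕ) (hb : ∀ n, (ℱ n) 0 = 𝒢 (r n))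
    (hc : ∀ ε : ℝ, ε ∈ Set.Ioo (0 : ℝ) 1 → ∀ᵐ ω ∂μ,
      Tendsto (fun n => ∑ k ∈ Finset.Icc 1 (s n),
          (μ[fun ω' => (D n k ω') ^ 2 *
              Set.indicator {ω'' | ε < |D n k ω''|} (fun _ => (1 : ℝ)) ω' | (ℱ n) (k - 1)]) ω)
        atTop (𝓝 (0 : ℝ)))
    (hd' : ∀ ε : ℝ, ε ∈ Set.Ioo (0 : ℝ) 1 → ∀ᵐ ω ∂μ,
      Tendsto (fun n =>
          (μ[Set.indicator
              {ω' | ε < |(∑ j ∈ Finset.Icc 1 (s n),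
                  (μ[fun ω'' => (D n j ω'') ^ 2 | (ℱ n) (j - 1)]) ω') - sl|}
              (fun _ => (1 : ℝ)) | (ℱ n) 0]) ω)
        atTop (𝓝 (0 : ℝ)))
    (lam : ℝ) :
    ∀ᵐ ω ∂μ, Tendsto
      (fun n => (μ[fun ω' => Complex.exp
          (((lam * ∑ k ∈ Finset.Icc 1 (s n), D n k ω' : ℝ) : ℂ) * Complex.I) | (ℱ n) 0]) ω)
      atTop (𝓝 ((Real.exp (-(sl * lam ^ 2) / 2) : ℝ) : ℂ)) := by
  -- rewrite the sums over `Icc 1 (s n)` as sums over `range (s n)`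
  have hIcc : ∀ {β : Type} [AddCommMonoid β] (f : ℕ → β) (n : ℕ),
      ∑ k ∈ Finset.Icc 1 n, f k = ∑ k ∈ Finset.range n, f (k + 1) := by
    intro β _ f n
    rw [← Finset.Ico_add_one_right_eq_Icc, Finset.sum_Ico_eq_sum_range]
    simp [add_comm]
  simp only [hIcc, Nat.add_sub_cancel] at hc hd' ⊢
  set X : ℕ → ℕ → Ω → ℝ := fun n k => D n (k + 1) with hXdef
  set K : ℝ := sl + 1 with hK
  set C : ℝ := Real.exp (lam ^ 2 / 2 * K) *
      (4 * |lam| ^ 3 + 4 * lam ^ 2 + lam ^ 4 * (1 + K)) with hC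
  have hK0 : 0 ≤ K := by linarith
  have hC0 : 0 ≤ C := by positivity
  set ε : ℕ → ℝ := fun i => 1 / ((i : ℝ) + 2) with hεdef
  have hε : ∀ i, ε i ∈ Set.Ioo (0 : ℝ) 1 := by
    intro i
    refine ⟨by positivity, ?_⟩
    rw [hεdef]
    simp only
    rw [div_lt_one (by positivity)]
    have : (0 : ℝ) ≤ i := Nat.cast_nonneg i
    linarith
  have htr := ae_all_iff.2 fun i : ℕ => ae_all_iff.2 fun n : ℕ =>
    aux_trunc (μ := μ) (ℱ n) (X n) (s n) sl hsl (fun k => ha_meas n (k + 1) (by omega))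
      (fun k => ha_int n (k + 1) (by omega)) (fun k => by
        have := ha_mart n (k + 1) (by omega)
        simpa using this) K hK (ε i) (hε i).1 (hε i).2 lam C hC
  have hG : ∀ᵐ ω ∂μ, ∀ i, Tendsto (fun n => (μ[fun ω => max 0 (min K
        (∑ k ∈ Finset.range (s n), (μ[fun ω' => (X n k ω') ^ 2 *
              Set.indicator {ω'' | ε i < |X n k ω''|} (fun _ => (1 : ℝ)) ω' | ℱ n k]) ω))
              | ℱ n 0]) ω) atTop (𝓝 0) := by
    rw [ae_all_iff]; intro i
    simp only [hb]
    refine aux_max 𝒢 r _ K (fun n => ?_) (fun n ω => le_max_left _ _)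
      (fun n ω => max_le hK0 (min_le_left _ _)) ?_
    · refine measurable_const.max (measurable_const.min (Finset.measurable_fun_sum _ fun k _ => ?_))
      exact (stronglyMeasurable_condExp.mono ((ℱ n).le k)).measurable
    · filter_upwards [hc (ε i) (hε i)] with ω h
      have hcont : Continuous fun x : ℝ => max 0 (min K x) := by fun_prop
      have := (hcont.tendsto 0).comp h
      simp only [min_eq_right hK0, max_self] at this
      exact this
  have hI := ae_all_iff.2 fun i : ℕ => hd' (ε i) (hε i)
  filter_upwards [htr, hG, hI] with ω h1 h2 h3
  rw [tendsto_iff_norm_sub_tendsto_zero, Metric.tendsto_atTop]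
  intro δ hδ
  obtain ⟨i, hi⟩ : ∃ i, C * (K + 1) * ε i < δ / 2 := by
    have hlim : Tendsto (fun i : ℕ => C * (K + 1) * ε i) atTop (𝓝 (C * (K + 1) * 0)) := by
      refine Tendsto.const_mul _ ?_
      have := (tendsto_one_div_add_atTop_nhds_zero_nat (𝕜 := ℝ)).comp (tendsto_add_atTop_nat 1)
      refine this.congr fun i => ?_
      simp only [Function.comp, hεdef]
      push_cast
      congr 1; ring
    rw [mul_zero] at hlim
    exact (hlim.eventually (gt_mem_nhds (by linarith))).exists
  have hlim := ((h2 i).const_mul C).add ((h3 i).const_mul (2 + C * K))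
  rw [mul_zero, mul_zero, add_zero] at hlim
  obtain ⟨N, hN⟩ := eventually_atTop.1 (hlim.eventually (gt_mem_nhds (by linarith : 0 < δ / 2)))
  refine ⟨N, fun n hn => ?_⟩
  rw [Real.dist_0_eq_abs, abs_of_nonneg (norm_nonneg _)]
  have a1 := h1 i n
  have a2 := hN n hn
  refine lt_of_le_of_lt a1 ?_
  linarith
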